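/- (Exact recovery of the leading noise coefficients.) Let 0 < p < 1, τ ≥ 1, m ≥ 1, let u, e : ℕ → ℝ be square-summable with the Laguerre spectrum of u satisfying u_k = 0 for all k < m, and define the measured output y(t) = u(t−τ) + e(t) (with u(t−τ) := 0 for t < τ). Then the Laguerre spectrum ŷ_j = Σ_{t=0}^∞ y(t)·ℓ_j(t;p) satisfies: ŷ_j = e_j for all j < m; ŷ_m = (√p)^τ·u_m + e_m; and ŷ_j = (1−p)·Σ_{k=m}^{j−1} L^{(τ)}_{j−k}(√p)·u_k + (√p)^τ·u_j + e_j for all j > m, where e_j is the Laguerre spectrum of e. -/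

import Mathlib

/-- The discrete Laguerre functions `ℓ_j(t; p)` in time-domain. -/
noncomputable def discreteLaguerre (p : ℝ) : ℕ → ℕ → ℝ
  | 0, t => Real.sqrt (1 - p) * Real.sqrt p ^ t
  | j + 1, 0 => -Real.sqrt p * discreteLaguerre p j 0
  | j + 1, t + 1 =>
      Real.sqrt p * discreteLaguerre p (j + 1) t + discreteLaguerre p j t
        - Real.sqrt p * discreteLaguerre p j (t + 1)
  termination_by j t => (j, t)

/-- The polynomial factor `L_m^{(τ)}(√p)` in the Laguerre-domain delay description. -/
noncomputable def delayLaguerrePoly (p : ℝ) (τ m : ℕ) : ℝ :=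
  (-Real.sqrt p) ^ ((m : ℤ) - (τ : ℤ)) *
    ∑ n ∈ Finset.range τ,
      ((m + n).choose n : ℝ) * ((m - 1).choose (τ - n - 1) : ℝ) * (-p) ^ n

open Finset

theorem discreteLaguerre_zero (p : ℝ) (t : ℕ) :
    discreteLaguerre p 0 t = √(1 - p) * √p ^ t := by
  rw [discreteLaguerre]

theorem discreteLaguerre_succ_succ (p : ℝ) (j t : ℕ) :
    discreteLaguerre p (j + 1) (t + 1) =
      √p * discreteLaguerre p (j + 1) t + discreteLaguerre p j t
        - √p * discreteLaguerre p j (t + 1) := by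
  rw [discreteLaguerre]

/-- A nonnegative sequence satisfying a contractive recursion with summable forcing is summable. -/
theorem summable_of_succ_le_mul_add {f g : ℕ → ℝ} {r : ℝ} (hf : ∀ t, 0 ≤ f t)
    (hg : ∀ t, 0 ≤ g t) (hgs : Summable g) (hr0 : 0 ≤ r) (hr1 : r < 1)
    (h : ∀ t, f (t + 1) ≤ r * f t + g t) : Summable f := by
  have hr : 0 < 1 - r := sub_pos.2 hr1
  have hG : 0 ≤ ∑' t, g t := tsum_nonneg hg
  refine summable_of_sum_range_le (c := (f 0 + ∑' t, g t) / (1 - r)) hf fun n => ?_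
  induction n with
  | zero => simpa using div_nonneg (add_nonneg (hf 0) hG) hr.le
  | succ n ih =>
    rw [sum_range_succ']
    calc ∑ t ∈ range n, f (t + 1) + f 0
        ≤ ∑ t ∈ range n, (r * f t + g t) + f 0 := by gcongr with t; exact h t
      _ = r * ∑ t ∈ range n, f t + ∑ t ∈ range n, g t + f 0 := by
        rw [sum_add_distrib, mul_sum]
      _ ≤ r * ((f 0 + ∑' t, g t) / (1 - r)) + ∑' t, g t + f 0 := by
        gcongr
        exact hgs.sum_le_tsum _ fun t _ => hg t
      _ = (f 0 + ∑' t, g t) / (1 - r) := by field_simp; ring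

theorem summable_abs_discreteLaguerre {p : ℝ} (hp1 : p < 1) (j : ℕ) :
    Summable fun t => |discreteLaguerre p j t| := by
  have hs0 := Real.sqrt_nonneg p
  have hs1 : √p < 1 := by rw [Real.sqrt_lt' one_pos]; simpa using hp1
  induction j with
  | zero =>
    simp_rw [discreteLaguerre_zero, abs_mul, abs_pow, abs_of_nonneg hs0]
    exact (summable_geometric_of_lt_one hs0 hs1).mul_left _
  | succ j ih =>
    refine summable_of_succ_le_mul_add (r := √p)
      (g := fun t => |discreteLaguerre p j t| + √p * |discreteLaguerre p j (t + 1)|)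
      (fun _ => abs_nonneg _) (fun _ => by positivity)
      (ih.add (((summable_nat_add_iff 1).2 ih).mul_left _)) hs0 hs1 fun t => ?_
    rw [discreteLaguerre_succ_succ]
    calc |√p * discreteLaguerre p (j + 1) t + discreteLaguerre p j t
            - √p * discreteLaguerre p j (t + 1)|
        ≤ |√p * discreteLaguerre p (j + 1) t| + |discreteLaguerre p j t|
            + |√p * discreteLaguerre p j (t + 1)| :=
          (abs_sub _ _).trans (by gcongr; exact abs_add_le _ _)
      _ = _ := by rw [abs_mul, abs_mul, abs_of_nonneg hs0]; ring

theorem summable_mul_discreteLaguerre {p : ℝ} (hp1 : p < 1) {w : ℕ → ℝ}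
    (hw : Summable fun t => w t ^ 2) (j : ℕ) :
    Summable fun t => w t * discreteLaguerre p j t := by
  refine Summable.of_norm_bounded
    ((summable_abs_discreteLaguerre hp1 j).mul_left (∑' t, w t ^ 2 + 1)) fun t => ?_
  rw [Real.norm_eq_abs, abs_mul]
  gcongr
  have h := hw.le_tsum t fun i _ => sq_nonneg (w i)
  rw [← sq_abs] at h
  nlinarith [sq_nonneg (|w t| - 1), abs_nonneg (w t)]

theorem delayLaguerrePoly_zero_left (p : ℝ) (m : ℕ) : delayLaguerrePoly p 0 m = 0 := by
  simp [delayLaguerrePoly]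

theorem delayLaguerrePoly_succ_one {p : ℝ} (hp0 : 0 < p) (τ : ℕ) :
    delayLaguerrePoly p (τ + 1) 1 = (τ + 1) * √p ^ τ := by
  have hs : √p ≠ 0 := (Real.sqrt_pos.2 hp0).ne'
  have hpow : (-p) ^ τ = (-√p) ^ τ * √p ^ τ := by
    rw [← mul_pow, neg_mul, Real.mul_self_sqrt hp0.le]
  have hz : (((1 : ℕ) : ℤ) - ((τ + 1 : ℕ) : ℤ)) = -(τ : ℤ) := by push_cast; ring
  have hsum : ∀ n ∈ range τ,
      ((1 + n).choose n : ℝ) * ((1 - 1).choose (τ + 1 - n - 1) : ℝ) * (-p) ^ n = 0 := by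
    intro n hn
    rw [mem_range] at hn
    rw [Nat.choose_eq_zero_of_lt (show 1 - 1 < τ + 1 - n - 1 by omega)]
    simp
  rw [delayLaguerrePoly, hz, sum_range_succ, sum_eq_zero hsum, hpow, zpow_neg, zpow_natCast,
    add_comm 1 τ, Nat.choose_succ_self_right]
  have : (-√p) ^ τ ≠ 0 := pow_ne_zero _ (neg_ne_zero.2 hs)
  simp only [add_tsub_cancel_left, tsub_self, Nat.choose_self]
  push_cast
  field_simp
  ring

/-- The first-order recursion of the delay polynomials, before scaling. -/
theorem sum_choose_mul_choose_mul_pow_succ (q : ℝ) (τ m : ℕ) :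
    ∑ n ∈ range (τ + 1), ((m + 2 + n).choose n : ℝ) * ((m + 1).choose (τ - n) : ℝ) * q ^ n =
      ∑ n ∈ range (τ + 1), ((m + 1 + n).choose n : ℝ) * (m.choose (τ - n) : ℝ) * q ^ n +
      q * ∑ n ∈ range τ, ((m + 2 + n).choose n : ℝ) * ((m + 1).choose (τ - n - 1) : ℝ) * q ^ n +
      ∑ n ∈ range τ, ((m + 1 + n).choose n : ℝ) * (m.choose (τ - n - 1) : ℝ) * q ^ n := by
  have hsplit : ∀ n ∈ range (τ + 1),
      ((m + 2 + n).choose n : ℝ) * ((m + 1).choose (τ - n) : ℝ) * q ^ n =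
      ((m + 1 + n).choose n : ℝ) * ((m + 1).choose (τ - n) : ℝ) * q ^ n +
      (if n = 0 then 0 else ((m + 1 + n).choose (n - 1) : ℝ)) *
        ((m + 1).choose (τ - n) : ℝ) * q ^ n := by
    rintro (_ | n) -
    · simp
    · have h : (m + 2 + (n + 1)).choose (n + 1) =
          (m + 1 + (n + 1)).choose n + (m + 1 + (n + 1)).choose (n + 1) := by
        rw [show m + 2 + (n + 1) = (m + 1 + (n + 1)) + 1 by ring, Nat.choose_succ_succ]
      rw [h]
      push_cast
      ring
  rw [sum_congr rfl hsplit, sum_add_distrib]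
  have hshift : ∑ n ∈ range (τ + 1),
      (if n = 0 then 0 else ((m + 1 + n).choose (n - 1) : ℝ)) *
        ((m + 1).choose (τ - n) : ℝ) * q ^ n =
      q * ∑ n ∈ range τ,
        ((m + 2 + n).choose n : ℝ) * ((m + 1).choose (τ - n - 1) : ℝ) * q ^ n := by
    rw [sum_range_succ', mul_sum]
    simp only [↓reduceIte, zero_mul, add_zero]
    refine sum_congr rfl fun n _ => ?_
    rw [if_neg n.succ_ne_zero, Nat.add_sub_cancel, ← Nat.sub_sub,
      show m + 1 + (n + 1) = m + 2 + n by ring]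
    ring
  have hpascal : ∑ n ∈ range (τ + 1),
      ((m + 1 + n).choose n : ℝ) * ((m + 1).choose (τ - n) : ℝ) * q ^ n =
      ∑ n ∈ range (τ + 1), ((m + 1 + n).choose n : ℝ) * (m.choose (τ - n) : ℝ) * q ^ n +
      ∑ n ∈ range τ, ((m + 1 + n).choose n : ℝ) * (m.choose (τ - n - 1) : ℝ) * q ^ n := by
    rw [sum_range_succ, sum_range_succ, add_right_comm (∑ n ∈ range τ, _), ← sum_add_distrib]
    congr 1
    · refine sum_congr rfl fun n hn => ?_
      obtain ⟨k, hk⟩ : ∃ k, τ - n = k + 1 := ⟨τ - n - 1, by grind⟩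
      rw [hk, Nat.choose_succ_succ, Nat.add_sub_cancel]
      push_cast
      ring
    · simp
  rw [hshift, hpascal]
  ring

theorem delayLaguerrePoly_succ_succ {p : ℝ} (hp0 : 0 < p) (τ m : ℕ) :
    delayLaguerrePoly p (τ + 1) (m + 2) =
      √p * delayLaguerrePoly p τ (m + 2) + delayLaguerrePoly p τ (m + 1)
        - √p * delayLaguerrePoly p (τ + 1) (m + 1) := by
  have hs : -√p ≠ 0 := neg_ne_zero.2 (Real.sqrt_pos.2 hp0).ne'
  have hsq : √p * √p = p := Real.mul_self_sqrt hp0.le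
  have h1 : (-√p) ^ (((m + 2 : ℕ) : ℤ) - ((τ + 1 : ℕ) : ℤ)) =
      -√p * (-√p) ^ (((m + 1 : ℕ) : ℤ) - ((τ + 1 : ℕ) : ℤ)) := by
    rw [← zpow_one_add₀ hs]; congr 1; push_cast; ring
  have h2 : (-√p) ^ (((m + 2 : ℕ) : ℤ) - (τ : ℤ)) =
      p * (-√p) ^ (((m + 1 : ℕ) : ℤ) - ((τ + 1 : ℕ) : ℤ)) := by
    rw [show p = -√p * -√p by rw [neg_mul_neg, hsq], mul_assoc, Real.sqrt_mul_self_eq_abs,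
      abs_neg, abs_of_nonneg (Real.sqrt_nonneg p), ← zpow_one_add₀ hs, ← zpow_one_add₀ hs]
    congr 1; push_cast; ring
  have h3 : (-√p) ^ (((m + 1 : ℕ) : ℤ) - (τ : ℤ)) =
      -√p * (-√p) ^ (((m + 1 : ℕ) : ℤ) - ((τ + 1 : ℕ) : ℤ)) := by
    rw [← zpow_one_add₀ hs]; congr 1; push_cast; ring
  have hrec := sum_choose_mul_choose_mul_pow_succ (-p) τ m
  have e1 : ∀ n, τ + 1 - n - 1 = τ - n := fun n => by omega
  simp only [delayLaguerrePoly, h1, h2, h3, e1, show m + 2 - 1 = m + 1 by omega,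
    show m + 1 - 1 = m by omega]
  rw [hrec]
  ring

/-- The coefficients expressing a delayed Laguerre function through undelayed ones. -/
noncomputable def delayCoeff (p : ℝ) (τ : ℕ) : ℕ → ℝ
  | 0 => √p ^ τ
  | m + 1 => (1 - p) * delayLaguerrePoly p τ (m + 1)

theorem delayCoeff_succ_succ {p : ℝ} (hp0 : 0 < p) (τ m : ℕ) :
    delayCoeff p (τ + 1) (m + 1) =
      √p * delayCoeff p τ (m + 1) + delayCoeff p τ m - √p * delayCoeff p (τ + 1) m := by
  have hsq : √p * √p = p := Real.mul_self_sqrt hp0.le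
  cases m with
  | zero =>
    simp only [delayCoeff, zero_add, delayLaguerrePoly_succ_one hp0]
    cases τ with
    | zero =>
      simp only [delayLaguerrePoly_zero_left]
      linear_combination hsq
    | succ τ =>
      rw [delayLaguerrePoly_succ_one hp0]
      push_cast
      linear_combination √p ^ (τ + 1) * hsq
  | succ m =>
    simp only [delayCoeff, delayLaguerrePoly_succ_succ hp0]
    ring

theorem discreteLaguerre_add {p : ℝ} (hp0 : 0 < p) (τ j t : ℕ) :
    discreteLaguerre p j (t + τ) =
      ∑ k ∈ range (j + 1), delayCoeff p τ (j - k) * discreteLaguerre p k t := by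
  induction τ generalizing j with
  | zero =>
    rw [sum_range_succ, sum_eq_zero fun k hk => ?_]
    · simp [delayCoeff]
    · obtain ⟨i, hi⟩ : ∃ i, j - k = i + 1 := ⟨j - k - 1, by grind⟩
      simp [hi, delayCoeff, delayLaguerrePoly_zero_left]
  | succ τ ih =>
    induction j with
    | zero => simp [discreteLaguerre_zero, delayCoeff]; ring
    | succ j ihj =>
      rw [← add_assoc, discreteLaguerre_succ_succ, ih, ih, add_assoc t τ 1, ihj,
        sum_range_succ _ (j + 1), sum_range_succ _ (j + 1), mul_add, mul_sum, mul_sum,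
        add_right_comm, add_sub_right_comm, ← sum_add_distrib, ← sum_sub_distrib]
      congr 1
      · refine sum_congr rfl fun k hk => ?_
        rw [Nat.succ_sub (by grind : k ≤ j), delayCoeff_succ_succ hp0]
        ring
      · simp [delayCoeff]; ring

/-- Laguerre spectrum of a delayed square-summable signal. -/
theorem hasSum_delay_mul_discreteLaguerre {p : ℝ} (hp0 : 0 < p) (hp1 : p < 1) (τ : ℕ)
    {u : ℕ → ℝ} (hu : Summable fun t => u t ^ 2) (j : ℕ) :
    HasSum (fun t => (if t < τ then 0 else u (t - τ)) * discreteLaguerre p j t)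
      (∑ k ∈ range (j + 1), delayCoeff p τ (j - k) * ∑' t, u t * discreteLaguerre p k t) := by
  have hhead : ∑ i ∈ range τ, (if i < τ then 0 else u (i - τ)) * discreteLaguerre p j i = 0 :=
    sum_eq_zero fun i hi => by simp [mem_range.1 hi]
  rw [← hasSum_nat_add_iff' τ, hhead, sub_zero]
  have h := hasSum_sum fun k (_ : k ∈ range (j + 1)) =>
    ((summable_mul_discreteLaguerre hp1 hu k).hasSum.mul_left (delayCoeff p τ (j - k)))
  refine h.congr_fun fun t => ?_
  simp only [Nat.not_lt.2 (Nat.le_add_left τ t), if_false, Nat.add_sub_cancel,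
    discreteLaguerre_add hp0, mul_sum]
  exact sum_congr rfl fun k _ => by ring

/-- Exact recovery of the leading noise coefficients: when the input spectrum starts
at index `m`, the first `m` Laguerre coefficients of the measured output coincide
with those of the noise, the `m`-th equals `(√p)^τ u_m + e_m`, and the later ones
follow the delay convolution formula plus the noise coefficients. -/
theorem noise_coefficients_recovery (p : ℝ) (hp0 : 0 < p) (hp1 : p < 1)
    (τ : ℕ) (hτ : 1 ≤ τ) (m : ℕ) (hm : 1 ≤ m)
    (u e : ℕ → ℝ) (hu : Summable fun t => u t ^ 2) (he : Summable fun t => e t ^ 2)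
    (huk : ∀ k : ℕ, k < m → (∑' t : ℕ, u t * discreteLaguerre p k t) = 0)
    (y : ℕ → ℝ) (hy : ∀ t : ℕ, y t = (if t < τ then 0 else u (t - τ)) + e t) :
    (∀ j : ℕ, j < m → (∑' t : ℕ, y t * discreteLaguerre p j t) =
        ∑' t : ℕ, e t * discreteLaguerre p j t) ∧
    ((∑' t : ℕ, y t * discreteLaguerre p m t) =
        Real.sqrt p ^ τ * (∑' t : ℕ, u t * discreteLaguerre p m t) +
          ∑' t : ℕ, e t * discreteLaguerre p m t) ∧
    (∀ j : ℕ, m < j → (∑' t : ℕ, y t * discreteLaguerre p j t) =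
        (1 - p) * (∑ k ∈ Finset.Ico m j,
            delayLaguerrePoly p τ (j - k) * ∑' t : ℕ, u t * discreteLaguerre p k t) +
          Real.sqrt p ^ τ * (∑' t : ℕ, u t * discreteLaguerre p j t) +
          ∑' t : ℕ, e t * discreteLaguerre p j t) := by
  have key : ∀ j, (∑' t : ℕ, y t * discreteLaguerre p j t) =
      (∑ k ∈ range (j + 1), delayCoeff p τ (j - k) * ∑' t, u t * discreteLaguerre p k t) +
        ∑' t : ℕ, e t * discreteLaguerre p j t := fun j => by
    simp only [hy, add_mul]
    exact ((hasSum_delay_mul_discreteLaguerre hp0 hp1 τ hu j).add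
      (summable_mul_discreteLaguerre hp1 he j).hasSum).tsum_eq
  have hzero : ∀ n ≤ m, ∀ c : ℕ → ℝ,
      ∑ k ∈ range n, c k * ∑' t, u t * discreteLaguerre p k t = 0 := fun n hn c =>
    sum_eq_zero fun k hk => by rw [huk k ((mem_range.1 hk).trans_le hn), mul_zero]
  refine ⟨fun j hj => ?_, ?_, fun j hj => ?_⟩
  · rw [key, hzero _ hj, zero_add]
  · rw [key, sum_range_succ, hzero _ le_rfl]
    simp [delayCoeff]
  · rw [key, sum_range_succ, ← sum_range_add_sum_Ico _ hj.le, hzero _ le_rfl, zero_add, mul_sum,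
      Nat.sub_self]
    congr 2
    refine sum_congr rfl fun k hk => ?_
    obtain ⟨i, hi⟩ : ∃ i, j - k = i + 1 := ⟨j - k - 1, by grind⟩
    rw [hi, delayCoeff, mul_assoc]
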